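/- Let A be a Hermitian n×n matrix over the split quaternion algebra H and let A_{j.}(a_{i.}) denote the matrix obtained from A by replacing its j-th row with its i-th row. Then for all i, j with i ≠ j, rdet_j A_{j.}(a_{i.}) = 0. -/

import Mathlib

/-- The split quaternion (coquaternion) algebra over ℝ:
`i² = −1`, `j² = 1`, `k² = 1`, `ij = −ji = k`. -/
abbrev SplitQuaternion : Type := QuaternionAlgebra ℝ (-1) 0 1

noncomputable section

namespace SplitQuaternion

variable {n : ℕ}

/-- The ordered product of entries of `A` along the cycle of `σ` containing `s`,
read in the "row" direction:
`a_{s, σ s} * a_{σ s, σ² s} * ⋯ * a_{σ^{L−1} s, s}` where `L` is the cycle length. -/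
def rowCycleProd (A : Matrix (Fin n) (Fin n) SplitQuaternion) (σ : Equiv.Perm (Fin n))
    (s : Fin n) : SplitQuaternion :=
  ((List.range (Function.minimalPeriod σ s)).map
    (fun m => A ((σ ^ m) s) ((σ ^ (m + 1)) s))).prod

/-- The ordered product of entries of `A` along the cycle of `σ` containing `s`,
read in the "column" direction:
`a_{s, σ^{L−1} s} * ⋯ * a_{σ² s, σ s} * a_{σ s, s}` where `L` is the cycle length. -/
def colCycleProd (A : Matrix (Fin n) (Fin n) SplitQuaternion) (σ : Equiv.Perm (Fin n))
    (s : Fin n) : SplitQuaternion :=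
  (((List.range (Function.minimalPeriod σ s)).map
    (fun m => A ((σ ^ (m + 1)) s) ((σ ^ m) s))).reverse).prod

open scoped Classical in
/-- The least elements of the cycles of `σ` other than the cycle containing `i`,
listed in increasing order. -/
def otherCycleMins (σ : Equiv.Perm (Fin n)) (i : Fin n) : List (Fin n) :=
  (Finset.univ.filter (fun s : Fin n =>
    (∀ t, σ.SameCycle s t → s ≤ t) ∧ ¬ σ.SameCycle i s)).sort (· ≤ ·)

/-- The `i`-th row determinant of `A`: the sum over all permutations `σ` of
`(−1)^{n−r}` (which is `sign σ`, `r` being the number of disjoint cycles of `σ`,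
fixed points included) times the product of the entries of `A` ordered according to
the left-ordered cycle notation of `σ` whose first cycle starts with `i`, every
other cycle starting with its least element, the cycles being ordered by
increasing least elements. -/
def rdet (A : Matrix (Fin n) (Fin n) SplitQuaternion) (i : Fin n) : SplitQuaternion :=
  ∑ σ : Equiv.Perm (Fin n),
    ((Equiv.Perm.sign σ : ℤ) : SplitQuaternion) *
      (rowCycleProd A σ i * ((otherCycleMins σ i).map (rowCycleProd A σ)).prod)

/-- The `j`-th column determinant of `A`: the sum over all permutations `τ` of
`(−1)^{n−r}` times the product of the entries of `A` ordered according to the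
right-ordered cycle notation of `τ` whose rightmost cycle ends with `j`, every
other cycle ending with its least element, the cycles being ordered (from right
to left) by increasing least elements. -/
def cdet (A : Matrix (Fin n) (Fin n) SplitQuaternion) (j : Fin n) : SplitQuaternion :=
  ∑ σ : Equiv.Perm (Fin n),
    ((Equiv.Perm.sign σ : ℤ) : SplitQuaternion) *
      ((((otherCycleMins σ j).reverse).map (colCycleProd A σ)).prod * colCycleProd A σ j)

/-- The determinant of a Hermitian matrix: the common value of all row and column
determinants (here given as `rdet` at the index `0`). -/
def hdet [NeZero n] (A : Matrix (Fin n) (Fin n) SplitQuaternion) : SplitQuaternion :=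
  rdet A 0


open Equiv.Perm Function

section Lists

theorem prod_map_range_add {M : Type*} [Monoid M] (f : ℕ → M) (a b : ℕ) :
    ((List.range (a + b)).map f).prod =
      ((List.range a).map f).prod * ((List.range b).map fun m => f (a + m)).prod := by
  induction b with
  | zero => simp
  | succ b ih => rw [← add_assoc, List.prod_range_succ, List.prod_range_succ, ih, mul_assoc]

theorem star_prod_map_range {M : Type*} [Monoid M] [StarMul M] (f : ℕ → M) (L : ℕ) :
    star ((List.range L).map f).prod =
      ((List.range L).map fun m => star (f (L - 1 - m))).prod := by
  induction L with
  | zero => simp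
  | succ L ih =>
    rw [List.prod_range_succ, star_mul, ih, List.prod_range_succ']
    simp only [Nat.add_sub_cancel, Nat.sub_zero]
    congr 2
    refine List.map_congr_left fun m _ => ?_
    rw [Nat.sub_sub, Nat.add_comm 1 m]

theorem prod_map_coe {ι : Type*} (l : List ι) (r : ι → ℝ) :
    (l.map fun s => (r s : SplitQuaternion)).prod = ((l.map r).prod : ℝ) := by
  induction l with
  | nil => simp
  | cons a l ih => simp only [List.map_cons, List.prod_cons, ih, QuaternionAlgebra.coe_mul]

end Lists

section Averaging

theorem re_mul_comm (a b : SplitQuaternion) : (a * b).re = (b * a).re := by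
  simp
  ring

theorem add_star_eq (a : SplitQuaternion) : a + star a = a.re + a.re := by
  rw [QuaternionAlgebra.self_add_star]
  simp [two_mul]

theorem sum_eq_sum_of_involution {α : Type*} (S : Finset α) (f g : α → SplitQuaternion)
    (φ : α → α) (hS : ∀ σ ∈ S, φ σ ∈ S) (hφ : ∀ σ, φ (φ σ) = σ)
    (h : ∀ σ ∈ S, f σ + f (φ σ) = g σ + g (φ σ)) : ∑ σ ∈ S, f σ = ∑ σ ∈ S, g σ := by
  have key (f : α → SplitQuaternion) : ∑ σ ∈ S, f (φ σ) = ∑ σ ∈ S, f σ :=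
    Finset.sum_nbij' φ φ hS hS (fun σ _ => hφ σ) (fun σ _ => hφ σ) fun _ _ => rfl
  have h2 := Finset.sum_congr rfl h
  rw [Finset.sum_add_distrib, Finset.sum_add_distrib, key, key, ← two_smul ℝ, ← two_smul ℝ] at h2
  exact smul_right_injective _ (two_ne_zero (α := ℝ)) h2

theorem sum_mul_mul_eq_sum_mul_re_mul {α : Type*} (S : Finset α) (X P Y : α → SplitQuaternion)
    (φ : α → α) (hS : ∀ σ ∈ S, φ σ ∈ S) (hφ : ∀ σ, φ (φ σ) = σ)
    (hX : ∀ σ ∈ S, X (φ σ) = X σ) (hP : ∀ σ ∈ S, P (φ σ) = star (P σ))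
    (hY : ∀ σ ∈ S, Y (φ σ) = Y σ) :
    ∑ σ ∈ S, X σ * P σ * Y σ = ∑ σ ∈ S, X σ * ((P σ).re : SplitQuaternion) * Y σ := by
  refine sum_eq_sum_of_involution S _ _ φ hS hφ fun σ h => ?_
  rw [hX σ h, hP σ h, hY σ h, ← add_mul, ← add_mul, ← mul_add, ← mul_add, add_star_eq]
  simp

/-- Averaging over the involutions `φ k`, each of which conjugates the factor indexed by `k`
and fixes the others, replaces every factor by its real part. -/
theorem sum_mul_list_prod_eq_re {α ι : Type*} [Fintype ι]
    (S : Finset α) (C : α → SplitQuaternion) (L : α → List ι) (P : α → ι → SplitQuaternion)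
    (φ : ι → α → α) (hS : ∀ k, ∀ σ ∈ S, φ k σ ∈ S) (hφ : ∀ k σ, φ k (φ k σ) = σ)
    (hL : ∀ k σ, L (φ k σ) = L σ) (hnd : ∀ σ, (L σ).Nodup)
    (hC : ∀ σ ∈ S, ∀ k ∈ L σ, C (φ k σ) = C σ)
    (hP : ∀ σ ∈ S, ∀ k ∈ L σ, P (φ k σ) k = star (P σ k))
    (hP' : ∀ σ ∈ S, ∀ k ∈ L σ, ∀ s ∈ L σ, s ≠ k → P (φ k σ) s = P σ s) :
    ∑ σ ∈ S, C σ * ((L σ).map (P σ)).prod =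
      ∑ σ ∈ S, C σ * ((((L σ).map fun s => (P σ s).re).prod : ℝ) : SplitQuaternion) := by
  classical
  have key (K : Finset ι) : ∑ σ ∈ S, C σ * ((L σ).map (P σ)).prod = ∑ σ ∈ S, C σ *
      ((L σ).map fun s => if s ∈ K then ((P σ s).re : SplitQuaternion) else P σ s).prod := by
    induction K using Finset.induction_on with
    | empty => simp
    | insert k K hk ih =>
      rw [ih]
      refine sum_eq_sum_of_involution S _ _ (φ k) (hS k) (hφ k) fun σ hσ => ?_
      by_cases hkL : k ∈ L σ
      · have hn := hnd σ
        rw [hC σ hσ k hkL, hL]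
        have hp := hP σ hσ k hkL
        have hp' := hP' σ hσ k hkL
        obtain ⟨l₁, l₂, hl⟩ := List.append_of_mem hkL
        rw [hl] at hn hp' ⊢
        have h₁ : k ∉ l₁ := by grind
        have h₂ : k ∉ l₂ := by grind
        have e (l : List ι) (hl : k ∉ l) (hsub : l ⊆ l₁ ++ k :: l₂) :
            (l.map fun s => if s ∈ K then ((P (φ k σ) s).re : SplitQuaternion)
              else P (φ k σ) s) =
            (l.map fun s => if s ∈ K then ((P σ s).re : SplitQuaternion) else P σ s) ∧
            (l.map fun s => if s ∈ insert k K then ((P (φ k σ) s).re : SplitQuaternion)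
              else P (φ k σ) s) =
            (l.map fun s => if s ∈ K then ((P σ s).re : SplitQuaternion) else P σ s) ∧
            (l.map fun s => if s ∈ insert k K then ((P σ s).re : SplitQuaternion)
              else P σ s) =
            (l.map fun s => if s ∈ K then ((P σ s).re : SplitQuaternion) else P σ s) := by
          have hne (s : ι) (hs : s ∈ l) : s ≠ k := fun h => hl (h ▸ hs)
          refine ⟨List.map_congr_left fun s hs => ?_, List.map_congr_left fun s hs => ?_,
            List.map_congr_left fun s hs => ?_⟩
          · rw [hp' s (hsub hs) (hne s hs)]
          · rw [hp' s (hsub hs) (hne s hs)]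
            simp [hne s hs]
          · simp [hne s hs]
        obtain ⟨a₁, a₂, a₃⟩ := e l₁ h₁ (by simp)
        obtain ⟨b₁, b₂, b₃⟩ := e l₂ h₂ (fun x hx => by simp [hx])
        simp only [List.map_append, List.map_cons, List.prod_append, List.prod_cons, a₁, a₂, a₃,
          b₁, b₂, b₃, if_neg hk, Finset.mem_insert_self, if_true, hp]
        rw [← mul_add, ← mul_add, ← mul_add, ← mul_add, ← add_mul, ← add_mul, add_star_eq]
        simp
      · have e (τ : α) (hτ : k ∉ L τ) :
            ((L τ).map fun s => if s ∈ K then ((P τ s).re : SplitQuaternion) else P τ s) =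
            ((L τ).map fun s => if s ∈ insert k K then ((P τ s).re : SplitQuaternion)
              else P τ s) :=
          List.map_congr_left fun s hs => by
            have : s ≠ k := fun h => hτ (h ▸ hs)
            simp [this]
        rw [e σ hkL, e (φ k σ) (by rwa [hL])]
  rw [key Finset.univ]
  simp only [Finset.mem_univ, if_true, prod_map_coe]

end Averaging

section Cycles

variable {σ τ : Equiv.Perm (Fin n)}

theorem isPeriodicPt_iff_pow (σ : Equiv.Perm (Fin n)) (m : ℕ) (x : Fin n) :
    IsPeriodicPt σ m x ↔ (σ ^ m) x = x := by
  rw [IsPeriodicPt, IsFixedPt, iterate_eq_pow]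

theorem pow_minimalPeriod_apply (σ : Equiv.Perm (Fin n)) (x : Fin n) :
    (σ ^ minimalPeriod σ x) x = x :=
  (isPeriodicPt_iff_pow ..).1 (isPeriodicPt_minimalPeriod σ x)

theorem minimalPeriod_pos (σ : Equiv.Perm (Fin n)) (x : Fin n) : 0 < minimalPeriod σ x :=
  IsPeriodicPt.minimalPeriod_pos (orderOf_pos σ)
    ((isPeriodicPt_iff_pow ..).2 (by rw [pow_orderOf_eq_one]; rfl))

theorem exists_pow_eq_of_sameCycle {x y : Fin n} (h : σ.SameCycle x y) :
    ∃ m, 0 < m ∧ m ≤ minimalPeriod σ x ∧ (σ ^ m) x = y := by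
  obtain ⟨m, rfl⟩ := h.exists_nat_pow_eq
  have hm : (σ ^ (m % minimalPeriod σ x)) x = (σ ^ m) x := by
    rw [← iterate_eq_pow, ← iterate_eq_pow, iterate_mod_minimalPeriod_eq]
  have hlt := Nat.mod_lt m (minimalPeriod_pos σ x)
  rcases Nat.eq_zero_or_pos (m % minimalPeriod σ x) with h0 | h0
  · refine ⟨_, minimalPeriod_pos σ x, le_rfl, ?_⟩
    rw [pow_minimalPeriod_apply, ← hm, h0, pow_zero, one_apply]
  · exact ⟨_, h0, hlt.le, hm⟩

theorem pow_apply_eq_of_eqOn_cycle {x : Fin n} (h : ∀ y, σ.SameCycle x y → τ y = σ y) (m : ℕ) :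
    (τ ^ m) x = (σ ^ m) x := by
  induction m with
  | zero => rfl
  | succ m ih =>
    rw [pow_succ', pow_succ', mul_apply, mul_apply, ih]
    exact h _ (sameCycle_pow_right.2 (SameCycle.refl ..))

theorem sameCycle_iff_of_eqOn_cycle {x : Fin n} (h : ∀ y, σ.SameCycle x y → τ y = σ y)
    (y : Fin n) : τ.SameCycle x y ↔ σ.SameCycle x y := by
  constructor <;> intro hy <;> obtain ⟨m, rfl⟩ := hy.exists_nat_pow_eq
  · rw [pow_apply_eq_of_eqOn_cycle h]
    exact sameCycle_pow_right.2 (SameCycle.refl ..)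
  · rw [← pow_apply_eq_of_eqOn_cycle h]
    exact sameCycle_pow_right.2 (SameCycle.refl ..)

theorem rowCycleProd_congr {A B : Matrix (Fin n) (Fin n) SplitQuaternion} {x : Fin n}
    (h : ∀ y, σ.SameCycle x y → τ y = σ y) (hAB : ∀ y, σ.SameCycle x y → B y = A y) :
    rowCycleProd B τ x = rowCycleProd A σ x := by
  have hp := pow_apply_eq_of_eqOn_cycle h
  have hper : minimalPeriod τ x = minimalPeriod σ x := by
    rw [minimalPeriod_eq_minimalPeriod_iff]
    intro m
    rw [isPeriodicPt_iff_pow, isPeriodicPt_iff_pow, hp]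
  unfold rowCycleProd
  rw [hper]
  congr 1
  refine List.map_congr_left fun m _ => ?_
  rw [hp, hp, hAB _ (sameCycle_pow_right.2 (SameCycle.refl ..))]

theorem rowCycleProd_inv {A : Matrix (Fin n) (Fin n) SplitQuaternion} (hA : A.IsHermitian)
    (σ : Equiv.Perm (Fin n)) (x : Fin n) :
    rowCycleProd A σ⁻¹ x = star (rowCycleProd A σ x) := by
  have hper : minimalPeriod (σ⁻¹ : Equiv.Perm (Fin n)) x = minimalPeriod σ x := by
    rw [minimalPeriod_eq_minimalPeriod_iff]
    intro m
    rw [isPeriodicPt_iff_pow, isPeriodicPt_iff_pow, inv_pow, inv_eq_iff_eq, eq_comm]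
  have hpow (m : ℕ) (hm : m ≤ minimalPeriod σ x) :
      (σ⁻¹ ^ m) x = (σ ^ (minimalPeriod σ x - m)) x := by
    rw [inv_pow, inv_eq_iff_eq, ← mul_apply, ← pow_add, Nat.add_sub_cancel' hm,
      pow_minimalPeriod_apply]
  unfold rowCycleProd
  rw [star_prod_map_range, hper]
  congr 1
  refine List.map_congr_left fun m hm => ?_
  rw [List.mem_range] at hm
  rw [hA.apply, hpow m hm.le, hpow (m + 1) hm]
  congr 2
  · congr 1
    omega
  · congr 1
    omega

theorem re_rowCycleProd_apply (A : Matrix (Fin n) (Fin n) SplitQuaternion)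
    (σ : Equiv.Perm (Fin n)) (x : Fin n) :
    (rowCycleProd A σ (σ x)).re = (rowCycleProd A σ x).re := by
  have hper : minimalPeriod σ (σ x) = minimalPeriod σ x :=
    minimalPeriod_apply (minimalPeriod_pos_iff_mem_periodicPts.1 (minimalPeriod_pos σ x))
  obtain ⟨L, hL⟩ := Nat.exists_eq_succ_of_ne_zero (minimalPeriod_pos σ x).ne'
  have hx : (σ ^ (L + 1)) x = x := by
    rw [← Nat.succ_eq_add_one, ← hL, pow_minimalPeriod_apply]
  have hσ (m : ℕ) : (σ ^ m) (σ x) = (σ ^ (m + 1)) x := by rw [pow_succ, mul_apply]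
  unfold rowCycleProd
  rw [hper, hL, Nat.succ_eq_add_one, List.prod_range_succ, List.prod_range_succ', re_mul_comm]
  simp only [hσ, pow_succ' σ (L + 1), mul_apply, hx]
  simp

theorem re_rowCycleProd_eq_of_sameCycle (A : Matrix (Fin n) (Fin n) SplitQuaternion)
    {x y : Fin n} (h : σ.SameCycle x y) :
    (rowCycleProd A σ x).re = (rowCycleProd A σ y).re := by
  obtain ⟨m, rfl⟩ := h.exists_nat_pow_eq
  clear h
  induction m with
  | zero => rfl
  | succ m ih => rw [pow_succ', mul_apply, re_rowCycleProd_apply, ih]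

end Cycles

section ReverseCycle

open scoped Classical in
/-- The permutation obtained from `σ` by reversing the cycle containing `k`. -/
def reverseCycle (k : Fin n) (σ : Equiv.Perm (Fin n)) : Equiv.Perm (Fin n) :=
  σ * (σ.cycleOf k)⁻¹ * (σ.cycleOf k)⁻¹

variable {σ : Equiv.Perm (Fin n)} {k x y : Fin n}

theorem sign_reverseCycle (k : Fin n) (σ : Equiv.Perm (Fin n)) :
    sign (reverseCycle k σ) = sign σ := by
  simp only [reverseCycle, map_mul, map_inv, mul_assoc, ← mul_inv, Int.units_mul_self, inv_one,
    mul_one]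

theorem reverseCycle_apply_of_sameCycle (h : σ.SameCycle k x) :
    reverseCycle k σ x = σ⁻¹ x := by
  classical
  have hinv (y : Fin n) (hy : σ.SameCycle k y) : σ.SameCycle k (σ⁻¹ y) := by
    rwa [← sameCycle_apply_right, ← mul_apply, mul_inv_cancel, one_apply]
  have key (y : Fin n) (hy : σ.SameCycle k y) : (σ.cycleOf k)⁻¹ y = σ⁻¹ y := by
    rw [inv_eq_iff_eq, (hinv y hy).cycleOf_apply, ← mul_apply, mul_inv_cancel,
      one_apply]
  have h2 : reverseCycle k σ x = σ ((σ.cycleOf k)⁻¹ ((σ.cycleOf k)⁻¹ x)) := by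
    unfold reverseCycle
    rw [mul_apply, mul_apply]
  rw [h2, key x h, key _ (hinv x h), ← mul_apply, mul_inv_cancel, one_apply]

theorem reverseCycle_apply_of_not_sameCycle (h : ¬ σ.SameCycle k x) :
    reverseCycle k σ x = σ x := by
  classical
  have key : (σ.cycleOf k)⁻¹ x = x := by
    rw [inv_eq_iff_eq, cycleOf_apply_of_not_sameCycle h]
  have h2 : reverseCycle k σ x = σ ((σ.cycleOf k)⁻¹ ((σ.cycleOf k)⁻¹ x)) := by
    unfold reverseCycle
    rw [mul_apply, mul_apply]
  rw [h2, key, key]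

theorem sameCycle_reverseCycle : (reverseCycle k σ).SameCycle x y ↔ σ.SameCycle x y := by
  by_cases h : σ.SameCycle k x
  · rw [← sameCycle_inv (f := σ)]
    exact sameCycle_iff_of_eqOn_cycle (fun z hz =>
      reverseCycle_apply_of_sameCycle (h.trans (sameCycle_inv.1 hz))) y
  · exact sameCycle_iff_of_eqOn_cycle (fun z hz =>
      reverseCycle_apply_of_not_sameCycle fun hk => h (hk.trans hz.symm)) y

theorem reverseCycle_reverseCycle (k : Fin n) (σ : Equiv.Perm (Fin n)) :
    reverseCycle k (reverseCycle k σ) = σ := by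
  ext x
  congr 1
  by_cases h : σ.SameCycle k x
  · rw [reverseCycle_apply_of_sameCycle (sameCycle_reverseCycle.2 h), inv_eq_iff_eq,
      reverseCycle_apply_of_sameCycle (sameCycle_apply_right.2 h), ← mul_apply, inv_mul_cancel, one_apply]
  · rw [reverseCycle_apply_of_not_sameCycle (mt sameCycle_reverseCycle.1 h),
      reverseCycle_apply_of_not_sameCycle h]

theorem rowCycleProd_reverseCycle_of_sameCycle {A : Matrix (Fin n) (Fin n) SplitQuaternion}
    (hA : A.IsHermitian) (h : σ.SameCycle k x) :
    rowCycleProd A (reverseCycle k σ) x = star (rowCycleProd A σ x) := by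
  rw [← rowCycleProd_inv hA]
  exact rowCycleProd_congr (fun z hz =>
    reverseCycle_apply_of_sameCycle (h.trans (sameCycle_inv.1 hz))) fun _ _ => rfl

theorem rowCycleProd_reverseCycle_of_not_sameCycle (A : Matrix (Fin n) (Fin n) SplitQuaternion)
    (h : ¬ σ.SameCycle k x) : rowCycleProd A (reverseCycle k σ) x = rowCycleProd A σ x :=
  rowCycleProd_congr (fun _ hz => reverseCycle_apply_of_not_sameCycle
    fun hk => h (hk.trans hz.symm)) fun _ _ => rfl

end ReverseCycle

section Swap

variable {σ : Equiv.Perm (Fin n)} {i j : Fin n}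

theorem mul_swap_pow_apply {a b : Fin n} {p : ℕ}
    (hp : ∀ m, 0 < m → m < p → (σ ^ m) a ≠ a ∧ (σ ^ m) a ≠ b) {m : ℕ} (hm : 0 < m)
    (hmp : m ≤ p) : ((σ * Equiv.swap a b) ^ m) b = (σ ^ m) a := by
  induction m, hm using Nat.le_induction with
  | base => simp
  | succ m hm ih =>
    obtain ⟨h1, h2⟩ := hp m hm hmp
    rw [pow_succ', mul_apply, ih (by omega), mul_apply, Equiv.swap_apply_of_ne_of_ne h1 h2,
      pow_succ', mul_apply]

theorem pow_apply_ne_of_lt_minimalPeriod {x : Fin n} {m : ℕ} (h0 : 0 < m)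
    (hm : m < minimalPeriod σ x) : (σ ^ m) x ≠ x := fun h =>
  not_isPeriodicPt_of_pos_of_lt_minimalPeriod h0.ne' hm ((isPeriodicPt_iff_pow ..).2 h)

theorem pow_apply_ne_of_not_sameCycle {x y : Fin n} (h : ¬ σ.SameCycle x y) (m : ℕ) :
    (σ ^ m) x ≠ y := fun hm => h (hm ▸ sameCycle_pow_right.2 (SameCycle.refl ..))

theorem not_sameCycle_mul_swap (hij : i ≠ j) (h : σ.SameCycle i j) :
    ¬ (σ * Equiv.swap i j).SameCycle i j := by
  have hex : ∃ m, 0 < m ∧ (σ ^ m) j = i := by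
    obtain ⟨m, h0, -, hm⟩ := exists_pow_eq_of_sameCycle h.symm
    exact ⟨m, h0, hm⟩
  classical
  obtain ⟨hp0, hp⟩ := Nat.find_spec hex
  have hmin (m : ℕ) (h0 : 0 < m) (hm : m < Nat.find hex) : (σ ^ m) j ≠ i := fun hi =>
    Nat.find_min hex hm ⟨h0, hi⟩
  generalize Nat.find hex = p at hp0 hp hmin
  have hne (m : ℕ) (h0 : 0 < m) (hm : m < p) : (σ ^ m) j ≠ j ∧ (σ ^ m) j ≠ i := by
    refine ⟨fun hj => hmin (p - m) (by omega) (by omega) ?_, hmin m h0 hm⟩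
    rw [← hp, ← Nat.sub_add_cancel hm.le, pow_add, mul_apply, hj, Nat.add_sub_cancel]
  have hpow {m : ℕ} (h0 : 0 < m) (hm : m ≤ p) :
      ((σ * Equiv.swap i j) ^ m) i = (σ ^ m) j := by
    rw [Equiv.swap_comm]
    exact mul_swap_pow_apply hne h0 hm
  intro hs
  obtain ⟨m, h0, hm, hmj⟩ := exists_pow_eq_of_sameCycle hs
  have hle : minimalPeriod (σ * Equiv.swap i j : Equiv.Perm (Fin n)) i ≤ p :=
    IsPeriodicPt.minimalPeriod_le hp0 ((isPeriodicPt_iff_pow ..).2 (by rw [hpow hp0 le_rfl, hp]))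
  rw [hpow h0 (hm.trans hle)] at hmj
  rcases (hm.trans hle).eq_or_lt with rfl | hlt
  · exact hij (hp.symm.trans hmj)
  · exact (hne m h0 hlt).1 hmj

theorem mul_swap_pow_apply_left (h : ¬ σ.SameCycle i j) {m : ℕ} (h0 : 0 < m)
    (hm : m ≤ minimalPeriod σ i) :
    ((σ * Equiv.swap i j) ^ m) j = (σ ^ m) i :=
  mul_swap_pow_apply (fun _ h0 hm => ⟨pow_apply_ne_of_lt_minimalPeriod h0 hm,
    pow_apply_ne_of_not_sameCycle h _⟩) h0 hm

theorem mul_swap_pow_add_apply (h : ¬ σ.SameCycle i j) {m : ℕ} (h0 : 0 < m)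
    (hm : m ≤ minimalPeriod σ j) :
    ((σ * Equiv.swap i j) ^ (minimalPeriod σ i + m)) j = (σ ^ m) j := by
  rw [add_comm, pow_add, mul_apply,
    mul_swap_pow_apply_left h (minimalPeriod_pos σ i) le_rfl, pow_minimalPeriod_apply,
    Equiv.swap_comm]
  exact mul_swap_pow_apply (fun _ h0 hm => ⟨pow_apply_ne_of_lt_minimalPeriod h0 hm,
    pow_apply_ne_of_not_sameCycle (fun h' => h h'.symm) _⟩) h0 hm

theorem minimalPeriod_mul_swap (h : ¬ σ.SameCycle i j) :
    minimalPeriod (σ * Equiv.swap i j : Equiv.Perm (Fin n)) j =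
      minimalPeriod σ i + minimalPeriod σ j := by
  have hi := minimalPeriod_pos σ i
  have hj := minimalPeriod_pos σ j
  refine le_antisymm (IsPeriodicPt.minimalPeriod_le (by omega) ((isPeriodicPt_iff_pow ..).2 ?_)) ?_
  · rw [mul_swap_pow_add_apply h hj le_rfl, pow_minimalPeriod_apply]
  · by_contra! hlt
    have hper := pow_minimalPeriod_apply (σ * Equiv.swap i j) j
    have hpos := minimalPeriod_pos (σ * Equiv.swap i j) j
    generalize minimalPeriod (σ * Equiv.swap i j : Equiv.Perm (Fin n)) j = m at *
    rcases le_or_gt m (minimalPeriod σ i) with hm | hm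
    · rw [mul_swap_pow_apply_left h hpos hm] at hper
      exact pow_apply_ne_of_not_sameCycle h m hper
    · obtain ⟨k, rfl⟩ := Nat.exists_eq_add_of_lt hm
      rw [add_assoc, mul_swap_pow_add_apply h (by omega) (by omega)] at hper
      exact pow_apply_ne_of_lt_minimalPeriod (by omega) (by omega) hper

theorem rowCycleProd_updateRow_mul_swap (h : ¬ σ.SameCycle i j)
    (A : Matrix (Fin n) (Fin n) SplitQuaternion) :
    rowCycleProd (A.updateRow j (A i)) (σ * Equiv.swap i j) j =
      rowCycleProd A σ i * rowCycleProd (A.updateRow j (A i)) σ j := by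
  have hij : i ≠ j := fun e => h (e ▸ SameCycle.refl ..)
  unfold rowCycleProd
  rw [minimalPeriod_mul_swap h, prod_map_range_add]
  congr 2 <;> refine List.map_congr_left fun m hm => ?_ <;> rw [List.mem_range] at hm
  · rw [mul_swap_pow_apply_left h m.succ_pos hm]
    rcases Nat.eq_zero_or_pos m with rfl | h0
    · simp
    · rw [mul_swap_pow_apply_left h h0 hm.le,
        Matrix.updateRow_ne (pow_apply_ne_of_not_sameCycle h m)]
  · rw [add_assoc, mul_swap_pow_add_apply h m.succ_pos hm]
    rcases Nat.eq_zero_or_pos m with rfl | h0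
    · rw [add_zero, mul_swap_pow_apply_left h (minimalPeriod_pos σ i) le_rfl,
        pow_minimalPeriod_apply, Matrix.updateRow_ne hij]
      simp
    · rw [mul_swap_pow_add_apply h h0 hm.le]

theorem mul_swap_apply_of_not_sameCycle {x : Fin n} (hi : ¬ σ.SameCycle i x)
    (hj : ¬ σ.SameCycle j x) (y : Fin n) (hy : σ.SameCycle x y) :
    (σ * Equiv.swap i j) y = σ y := by
  rw [mul_apply, Equiv.swap_apply_of_ne_of_ne]
  · rintro rfl
    exact hi hy.symm
  · rintro rfl
    exact hj hy.symm

theorem sameCycle_mul_swap_iff (h : ¬ σ.SameCycle i j) {x : Fin n} :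
    (σ * Equiv.swap i j).SameCycle j x ↔ σ.SameCycle i x ∨ σ.SameCycle j x := by
  constructor
  · contrapose!
    rintro ⟨hi, hj⟩ hx
    exact hj ((sameCycle_iff_of_eqOn_cycle (mul_swap_apply_of_not_sameCycle hi hj) j).1
      hx.symm).symm
  · rintro (hx | hx) <;> obtain ⟨m, h0, hm, rfl⟩ := exists_pow_eq_of_sameCycle hx
    · rw [← mul_swap_pow_apply_left h h0 hm]
      exact sameCycle_pow_right.2 (SameCycle.refl ..)
    · rw [← mul_swap_pow_add_apply h h0 hm]
      exact sameCycle_pow_right.2 (SameCycle.refl ..)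

end Swap

section CycleMins

variable {σ : Equiv.Perm (Fin n)} {i j s : Fin n}

open scoped Classical in
/-- The least elements of the cycles of `σ` containing neither `i` nor `j`. -/
def remainingCycleMins (σ : Equiv.Perm (Fin n)) (i j : Fin n) : List (Fin n) :=
  (Finset.univ.filter (fun s : Fin n => (∀ t, σ.SameCycle s t → s ≤ t) ∧
    ¬ (σ.SameCycle i s ∨ σ.SameCycle j s))).sort (· ≤ ·)

theorem mem_otherCycleMins :
    s ∈ otherCycleMins σ j ↔ (∀ t, σ.SameCycle s t → s ≤ t) ∧ ¬ σ.SameCycle j s := by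
  simp [otherCycleMins]

theorem mem_remainingCycleMins :
    s ∈ remainingCycleMins σ i j ↔
      (∀ t, σ.SameCycle s t → s ≤ t) ∧ ¬ (σ.SameCycle i s ∨ σ.SameCycle j s) := by
  simp [remainingCycleMins]

theorem otherCycleMins_nodup (σ : Equiv.Perm (Fin n)) (j : Fin n) :
    (otherCycleMins σ j).Nodup :=
  Finset.sort_nodup ..

theorem remainingCycleMins_nodup (σ : Equiv.Perm (Fin n)) (i j : Fin n) :
    (remainingCycleMins σ i j).Nodup :=
  Finset.sort_nodup ..

theorem otherCycleMins_reverseCycle (k : Fin n) (σ : Equiv.Perm (Fin n)) (j : Fin n) :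
    otherCycleMins (reverseCycle k σ) j = otherCycleMins σ j := by
  simp only [otherCycleMins, sameCycle_reverseCycle]

theorem remainingCycleMins_reverseCycle (k : Fin n) (σ : Equiv.Perm (Fin n)) (i j : Fin n) :
    remainingCycleMins (reverseCycle k σ) i j = remainingCycleMins σ i j := by
  simp only [remainingCycleMins, sameCycle_reverseCycle]

theorem otherCycleMins_mul_swap (h : ¬ σ.SameCycle i j) :
    otherCycleMins (σ * Equiv.swap i j) j = remainingCycleMins σ i j := by
  unfold otherCycleMins remainingCycleMins
  congr 1
  refine Finset.filter_congr fun s _ => ?_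
  rw [sameCycle_mul_swap_iff h]
  refine and_congr_left fun hs => ?_
  rw [not_or] at hs
  simp only [sameCycle_iff_of_eqOn_cycle (mul_swap_apply_of_not_sameCycle hs.1 hs.2)]

theorem eq_of_sameCycle_of_forall_le {s t : Fin n} (h : σ.SameCycle s t)
    (hs : ∀ x, σ.SameCycle s x → s ≤ x) (ht : ∀ x, σ.SameCycle t x → t ≤ x) : s = t :=
  le_antisymm (hs t h) (ht s h.symm)

theorem exists_sameCycle_forall_le (σ : Equiv.Perm (Fin n)) (i : Fin n) :
    ∃ m, σ.SameCycle i m ∧ ∀ x, σ.SameCycle m x → m ≤ x := by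
  classical
  obtain ⟨m, hm, hmin⟩ := (Finset.univ.filter (σ.SameCycle i)).exists_minimal
    ⟨i, by simp [SameCycle.refl]⟩
  simp only [Finset.mem_filter, Finset.mem_univ, true_and] at hm hmin
  exact ⟨m, hm, fun x hx => (le_total m x).elim id fun hx' => hmin (hm.trans hx) hx'⟩

theorem otherCycleMins_prod_re (A : Matrix (Fin n) (Fin n) SplitQuaternion)
    (h : ¬ σ.SameCycle i j) :
    ((otherCycleMins σ j).map fun s => (rowCycleProd A σ s).re).prod =
      (rowCycleProd A σ i).re *
        ((remainingCycleMins σ i j).map fun s => (rowCycleProd A σ s).re).prod := by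
  obtain ⟨m, hm, hmin⟩ := exists_sameCycle_forall_le σ i
  have hperm : (otherCycleMins σ j).Perm (m :: remainingCycleMins σ i j) := by
    refine (List.perm_ext_iff_of_nodup (otherCycleMins_nodup σ j)
      (List.nodup_cons.2 ⟨fun hmem => (mem_remainingCycleMins.1 hmem).2 (Or.inl hm),
        remainingCycleMins_nodup σ i j⟩)).2 fun s => ?_
    rw [List.mem_cons, mem_otherCycleMins, mem_remainingCycleMins]
    constructor
    · rintro ⟨hs, hj⟩
      by_cases hi : σ.SameCycle i s
      · exact Or.inl (eq_of_sameCycle_of_forall_le (hi.symm.trans hm) hs hmin)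
      · exact Or.inr ⟨hs, not_or.2 ⟨hi, hj⟩⟩
    · rintro (rfl | ⟨hs, hij⟩)
      · exact ⟨hmin, fun hj => h (hm.trans hj.symm)⟩
      · exact ⟨hs, fun hj => hij (Or.inr hj)⟩
  rw [(hperm.map _).prod_eq, List.map_cons, List.prod_cons, re_rowCycleProd_eq_of_sameCycle A hm]

end CycleMins

section Cancellation

variable {i j : Fin n}

theorem sum_otherCycleMins_eq {A : Matrix (Fin n) (Fin n) SplitQuaternion} (hA : A.IsHermitian)
    (B : Matrix (Fin n) (Fin n) SplitQuaternion) (S : Finset (Equiv.Perm (Fin n)))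
    (hS : ∀ k, ∀ σ ∈ S, reverseCycle k σ ∈ S) :
    ∑ σ ∈ S, ((sign σ : ℤ) : SplitQuaternion) * rowCycleProd B σ j *
        ((otherCycleMins σ j).map (rowCycleProd A σ)).prod =
      ∑ σ ∈ S, ((sign σ : ℤ) : SplitQuaternion) * rowCycleProd B σ j *
        ((((otherCycleMins σ j).map fun s => (rowCycleProd A σ s).re).prod : ℝ) :
          SplitQuaternion) := by
  refine sum_mul_list_prod_eq_re S _ _ _ reverseCycle hS reverseCycle_reverseCycle
    (fun k σ => otherCycleMins_reverseCycle k σ j) (fun σ => otherCycleMins_nodup σ j) ?_ ?_ ?_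
  · intro σ _ k hk
    rw [sign_reverseCycle, rowCycleProd_reverseCycle_of_not_sameCycle]
    exact fun hkj => (mem_otherCycleMins.1 hk).2 hkj.symm
  · intro σ _ k _
    exact rowCycleProd_reverseCycle_of_sameCycle hA (SameCycle.refl ..)
  · intro σ _ k hk s hs hne
    refine rowCycleProd_reverseCycle_of_not_sameCycle A fun hks => hne ?_
    exact (eq_of_sameCycle_of_forall_le hks (mem_otherCycleMins.1 hk).1
      (mem_otherCycleMins.1 hs).1).symm

theorem sum_remainingCycleMins_eq {A : Matrix (Fin n) (Fin n) SplitQuaternion}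
    (hA : A.IsHermitian) (B : Matrix (Fin n) (Fin n) SplitQuaternion)
    (S : Finset (Equiv.Perm (Fin n))) (hS : ∀ k, ∀ σ ∈ S, reverseCycle k σ ∈ S)
    (hij : ∀ σ ∈ S, ¬ σ.SameCycle i j) :
    ∑ σ ∈ S, ((sign σ : ℤ) : SplitQuaternion) * rowCycleProd A σ i *
        (rowCycleProd B σ j * ((remainingCycleMins σ i j).map (rowCycleProd A σ)).prod) =
      ∑ σ ∈ S, ((sign σ : ℤ) : SplitQuaternion) * ((rowCycleProd A σ i).re : SplitQuaternion) *
        rowCycleProd B σ j *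
        ((((remainingCycleMins σ i j).map fun s => (rowCycleProd A σ s).re).prod : ℝ) :
          SplitQuaternion) := by
  have hrest (σ : Equiv.Perm (Fin n)) (k : Fin n) (hk : ∀ s ∈ remainingCycleMins σ i j,
      ¬ σ.SameCycle k s) : (remainingCycleMins σ i j).map (rowCycleProd A (reverseCycle k σ)) =
        (remainingCycleMins σ i j).map (rowCycleProd A σ) :=
    List.map_congr_left fun s hs => rowCycleProd_reverseCycle_of_not_sameCycle A (hk s hs)
  rw [sum_mul_mul_eq_sum_mul_re_mul S _ _ _ (reverseCycle i) (hS i) (reverseCycle_reverseCycle i)]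
  · simp only [← mul_assoc]
    refine sum_mul_list_prod_eq_re S _ _ _ reverseCycle hS reverseCycle_reverseCycle
      (fun k σ => remainingCycleMins_reverseCycle k σ i j)
      (fun σ => remainingCycleMins_nodup σ i j) ?_ ?_ ?_
    · intro σ _ k hk
      have hk' := not_or.1 (mem_remainingCycleMins.1 hk).2
      rw [sign_reverseCycle, rowCycleProd_reverseCycle_of_not_sameCycle A fun h => hk'.1 h.symm,
        rowCycleProd_reverseCycle_of_not_sameCycle B fun h => hk'.2 h.symm]
    · intro σ _ k _
      exact rowCycleProd_reverseCycle_of_sameCycle hA (SameCycle.refl ..)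
    · intro σ _ k hk s hs hne
      refine rowCycleProd_reverseCycle_of_not_sameCycle A fun hks => hne ?_
      exact (eq_of_sameCycle_of_forall_le hks (mem_remainingCycleMins.1 hk).1
        (mem_remainingCycleMins.1 hs).1).symm
  · intro σ _
    rw [sign_reverseCycle]
  · intro σ _
    exact rowCycleProd_reverseCycle_of_sameCycle hA (SameCycle.refl ..)
  · intro σ hσ
    rw [rowCycleProd_reverseCycle_of_not_sameCycle B (hij σ hσ), remainingCycleMins_reverseCycle,
      hrest σ i fun s hs hi => (mem_remainingCycleMins.1 hs).2 (Or.inl hi)]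

end Cancellation

/-- If the `j`-th row of a Hermitian matrix `A` is replaced with its `i`-th row,
`i ≠ j`, then the `j`-th row determinant of the resulting matrix vanishes. -/
theorem rdet_updateRow_eq_zero_of_isHermitian (A : Matrix (Fin n) (Fin n) SplitQuaternion)
    (hA : A.IsHermitian) (i j : Fin n) (hij : i ≠ j) :
    rdet (A.updateRow j (A i)) j = 0 := by
  classical
  set B := A.updateRow j (A i)
  let S : Finset (Equiv.Perm (Fin n)) := Finset.univ.filter fun σ => ¬ σ.SameCycle i j
  have hmem (σ : Equiv.Perm (Fin n)) : σ ∈ S ↔ ¬ σ.SameCycle i j := by simp [S]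
  have hS (k : Fin n) (σ : Equiv.Perm (Fin n)) (hσ : σ ∈ S) : reverseCycle k σ ∈ S := by
    rwa [hmem, sameCycle_reverseCycle, ← hmem]
  have hBA {σ : Equiv.Perm (Fin n)} {s : Fin n} (hs : ¬ σ.SameCycle j s) :
      rowCycleProd B σ s = rowCycleProd A σ s :=
    rowCycleProd_congr (fun _ _ => rfl) fun y hy =>
      Matrix.updateRow_ne fun e => hs (e ▸ hy.symm)
  have hsplit : rdet B j =
      ∑ σ ∈ S, ((sign σ : ℤ) : SplitQuaternion) * rowCycleProd B σ j *
        ((otherCycleMins σ j).map (rowCycleProd A σ)).prod +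
      ∑ σ ∈ S, -(((sign σ : ℤ) : SplitQuaternion) * rowCycleProd A σ i *
        (rowCycleProd B σ j * ((remainingCycleMins σ i j).map (rowCycleProd A σ)).prod)) := by
    unfold rdet
    rw [← Finset.sum_filter_not_add_sum_filter _ fun σ => σ.SameCycle i j]
    congr 1
    · refine Finset.sum_congr rfl fun σ _ => ?_
      rw [mul_assoc]
      congr 3
      exact List.map_congr_left fun s hs => hBA (mem_otherCycleMins.1 hs).2
    · symm
      refine Finset.sum_nbij' (· * Equiv.swap i j) (· * Equiv.swap i j) ?_ ?_ ?_ ?_ ?_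
      · intro σ hσ
        rw [hmem] at hσ
        rw [Finset.mem_filter]
        exact ⟨Finset.mem_univ _,
          ((sameCycle_mul_swap_iff hσ).2 (Or.inl (SameCycle.refl ..))).symm⟩
      · intro σ hσ
        rw [Finset.mem_filter] at hσ
        exact (hmem _).2 (not_sameCycle_mul_swap hij hσ.2)
      · intro σ _
        simp [mul_assoc]
      · intro σ _
        simp [mul_assoc]
      · intro σ hσ
        rw [hmem] at hσ
        rw [rowCycleProd_updateRow_mul_swap hσ, otherCycleMins_mul_swap hσ, Equiv.Perm.sign_mul,
          sign_swap hij]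
        have hrest : (remainingCycleMins σ i j).map (rowCycleProd B (σ * Equiv.swap i j)) =
            (remainingCycleMins σ i j).map (rowCycleProd A σ) := by
          refine List.map_congr_left fun s hs => ?_
          obtain ⟨hi, hj⟩ := not_or.1 (mem_remainingCycleMins.1 hs).2
          rw [← hBA hj]
          exact rowCycleProd_congr (mul_swap_apply_of_not_sameCycle hi hj) fun _ _ => rfl
        rw [hrest]
        simp [B, mul_assoc]
  rw [hsplit, Finset.sum_neg_distrib, sum_otherCycleMins_eq hA B S hS,
    sum_remainingCycleMins_eq hA B S hS fun σ hσ => (hmem σ).1 hσ, ← sub_eq_add_neg, sub_eq_zero]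
  refine Finset.sum_congr rfl fun σ hσ => ?_
  rw [otherCycleMins_prod_re A ((hmem σ).1 hσ), QuaternionAlgebra.coe_mul, ← mul_assoc,
    mul_assoc _ _ ((rowCycleProd A σ i).re : SplitQuaternion),
    ← QuaternionAlgebra.coe_commutes _ (rowCycleProd B σ j), ← mul_assoc]

end SplitQuaternion

end
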